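/- If a function f : ℍ → ℍ is H-differentiable at a point z⁰ ∈ ℍ with H-derivative d₁ and also H-differentiable at z⁰ with H-derivative d₂, then d₁ = d₂; that is, the H-derivative at a point is unique (it equals the partial derivative of f at z⁰ with respect to the real coordinate, i.e. the derivative at t = 0 of the map t ↦ f(z⁰ + t·1) for real t). -/

import Mathlib

open scoped Quaternion
open Filter Topology

/-- A function `f : ℍ → ℍ` is H-differentiable at `z₀` with H-derivative `d` if there exist
sequences of quaternions `A, B` with `∑ ‖A k‖ * ‖B k‖ < ∞` such that
`f (z₀ + h) - f z₀ = ∑' k, A k * h * B k + ω h` with `‖ω h‖ / ‖h‖ → 0` as `h → 0`,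
and `d = ∑' k, A k * B k`. -/
def HDiffAt (f : ℍ[ℝ] → ℍ[ℝ]) (z₀ d : ℍ[ℝ]) : Prop :=
  ∃ A B : ℕ → ℍ[ℝ],
    (Summable fun k => ‖A k‖ * ‖B k‖) ∧
    Filter.Tendsto
      (fun h : ℍ[ℝ] => ‖f (z₀ + h) - f z₀ - ∑' k, A k * h * B k‖ / ‖h‖)
      (𝓝[≠] (0 : ℍ[ℝ])) (𝓝 0) ∧
    d = ∑' k, A k * B k

/-- The H-derivative is the partial derivative in the real direction. -/
theorem HDiffAt.hasDerivAt {f : ℍ[ℝ] → ℍ[ℝ]} {z₀ d : ℍ[ℝ]} (h : HDiffAt f z₀ d) :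
    HasDerivAt (fun t : ℝ => f (z₀ + t • (1 : ℍ[ℝ]))) d 0 := by
  obtain ⟨A, B, -, hlim, rfl⟩ := h
  have hline : Tendsto (fun t : ℝ => t • (1 : ℍ[ℝ])) (𝓝[≠] 0) (𝓝[≠] 0) := by
    refine tendsto_nhdsWithin_iff.2 ⟨?_, ?_⟩
    · have hcont : Continuous fun t : ℝ => t • (1 : ℍ[ℝ]) := by fun_prop
      exact (hcont.tendsto' 0 0 (zero_smul _ _)).mono_left nhdsWithin_le_nhds
    · filter_upwards [self_mem_nhdsWithin] with t ht
      exact smul_ne_zero ht one_ne_zero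
  rw [hasDerivAt_iff_tendsto_slope_zero, tendsto_iff_norm_sub_tendsto_zero]
  refine (hlim.comp hline).congr' ?_
  filter_upwards [self_mem_nhdsWithin] with t ht
  have ht : t ≠ 0 := ht
  have hsum : ∑' k, A k * (t • (1 : ℍ[ℝ])) * B k = t • ∑' k, A k * B k := by
    simp only [mul_smul_comm, smul_mul_assoc, mul_one]
    exact tsum_const_smul'' t
  simp only [Function.comp_apply, hsum, zero_add, zero_smul, add_zero, norm_smul, norm_one,
    mul_one]
  rw [div_eq_inv_mul, ← norm_inv, ← norm_smul, smul_sub, inv_smul_smul₀ ht]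

/-- The H-derivative at a point is unique. -/
theorem hDiffAt_unique (f : ℍ[ℝ] → ℍ[ℝ]) (z₀ d₁ d₂ : ℍ[ℝ])
    (h₁ : HDiffAt f z₀ d₁) (h₂ : HDiffAt f z₀ d₂) : d₁ = d₂ := by
  exact h₁.hasDerivAt.unique h₂.hasDerivAt
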